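/- arXiv:1701.03677 — 2 statements merged into one kernel-verified Lean document; each statement's English description precedes it below -/
import Mathlib

section
/- Let m ≥ 0 be an integer and let I_Z = (x_0,x_2)^m ∩ (x_0,x_3)^m ∩ (x_1,x_2)^m be the ideal of the homogeneous set of fat points Z = m P_11 + m P_12 + m P_21. Then for every (a,b) ∈ ℕ², β_0,(a,b)(I_Z) = φ_{m+1}(b) if a + b = 2m, and β_0,(a,b)(I_Z) = 0 otherwise. -/
open MvPolynomial Module

noncomputable section

/-- The recursively defined function `φ_t(n)` (natural index). -/
def phiNat : ℕ → ℤ → ℤ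
  | 0, _ => 0
  | 1, n => if n = 0 then 1 else 0
  | (t+2), n =>
    if 0 ≤ n ∧ n < (t : ℤ) + 1 then phiNat (t+1) n
    else if (t : ℤ) + 1 ≤ n ∧ n < 2 * ((t : ℤ) + 1) + 1 then phiNat (t+1) n + 1
    else 0

/-- `φ_t : ℤ → ℤ`, identically `0` for `t ≤ 0`. -/
def phi (t n : ℤ) : ℤ := if 0 < t then phiNat t.toNat n else 0

/-- `φ_{t,d}(n) = φ_t(n+d) − φ_d(n+d)`. -/
def phi2 (t d n : ℤ) : ℤ := phi t (n + d) - phi d (n + d)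

/-- `(n)_+ = max{n, 0}`. -/
def pos (n : ℤ) : ℤ := max n 0

variable (k : Type*) [Field k] [CharZero k]

/-- The bigrading weights on `k[x₀,x₁,x₂,x₃]`. -/
def w : Fin 4 → ℕ × ℕ := ![(1,0), (1,0), (0,1), (0,1)]

/-- The bihomogeneous component `R_{(a,b)}` as a `k`-subspace. -/
def comp (a b : ℕ) : Submodule k (MvPolynomial (Fin 4) k) :=
  weightedHomogeneousSubmodule k w (a, b)

/-- The irrelevant ideal `𝔪 = (x₀,x₁,x₂,x₃)`. -/
def mIdeal : Ideal (MvPolynomial (Fin 4) k) :=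
  Ideal.span {X 0, X 1, X 2, X 3}

/-- `β_{0,(a,b)}(I) = dim_k (I ∩ R_{(a,b)}) − dim_k ((𝔪·I) ∩ R_{(a,b)})`. -/
def beta0 (I : Ideal (MvPolynomial (Fin 4) k)) (a b : ℕ) : ℤ :=
  (finrank k ↥(I.restrictScalars k ⊓ comp k a b) : ℤ)
    - (finrank k ↥((mIdeal k * I).restrictScalars k ⊓ comp k a b) : ℤ)

/-- The Hilbert function `H(a,b) = (a+1)(b+1) − dim_k (I ∩ R_{(a,b)})`, `0` off `ℕ²`. -/
def HF (I : Ideal (MvPolynomial (Fin 4) k)) (a b : ℤ) : ℤ :=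
  if 0 ≤ a ∧ 0 ≤ b then
    (a + 1) * (b + 1) - (finrank k ↥(I.restrictScalars k ⊓ comp k a.toNat b.toNat) : ℤ)
  else 0

/-- The first difference `ΔH(a,b)`. -/
def dHF (I : Ideal (MvPolynomial (Fin 4) k)) (a b : ℤ) : ℤ :=
  HF k I a b + HF k I (a-1) (b-1) - HF k I (a-1) b - HF k I a (b-1)

def I11 : Ideal (MvPolynomial (Fin 4) k) := Ideal.span {X 0, X 2}
def I12 : Ideal (MvPolynomial (Fin 4) k) := Ideal.span {X 0, X 3}
def I21 : Ideal (MvPolynomial (Fin 4) k) := Ideal.span {X 1, X 2}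

/-- The ideal of `Z = m₁₁P₁₁ + m₁₂P₁₂ + m₂₁P₂₁`. -/
def IZ (m11 m12 m21 : ℕ) : Ideal (MvPolynomial (Fin 4) k) :=
  I11 k ^ m11 ⊓ I12 k ^ m12 ⊓ I21 k ^ m21

/-- `max{m₁₁, m₁₂ + m₂₁}`. -/
def Dbound (m11 m12 m21 : ℕ) : ℤ := max (m11 : ℤ) ((m12 : ℤ) + m21)

def D1set (m11 m12 m21 : ℕ) : Set (ℕ × ℕ) :=
  {p | (p.2 : ℤ) < pos (-((m12 : ℤ) - m11)) - pos (-((m12 : ℤ) - m11) - m21) ∧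
       (p.1 : ℤ) + 2 * p.2 = (m11 : ℤ) + m21}

def D2set (m11 m12 m21 : ℕ) : Set (ℕ × ℕ) :=
  {p | pos (-((m12 : ℤ) - m11)) - pos (-((m12 : ℤ) - m11) - m21) ≤ (p.2 : ℤ) ∧
       (p.2 : ℤ) < m21 ∧ (p.1 : ℤ) + p.2 = Dbound m11 m12 m21}

def D3set (m11 m12 m21 : ℕ) : Set (ℕ × ℕ) :=
  {p | (m21 : ℤ) ≤ p.2 ∧ (p.2 : ℤ) ≤ m21 + |((m12 : ℤ) - m11) + m21| ∧
       (p.1 : ℤ) + p.2 = Dbound m11 m12 m21}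

def D4set (m11 m12 m21 : ℕ) : Set (ℕ × ℕ) :=
  {p | (m21 : ℤ) + |((m12 : ℤ) - m11) + m21| < (p.2 : ℤ) ∧
       2 * (p.1 : ℤ) + p.2 = (m11 : ℤ) + m12}


open Pointwise in
theorem mul_mem_restrictSupportIdeal {σ R : Type*} [CommSemiring R] {S T U : Set (σ →₀ ℕ)}
    {hS : IsUpperSet S} {hT : IsUpperSet T} (hU : IsUpperSet U)
    (h : ∀ s ∈ S, ∀ t ∈ T, s + t ∈ U) {f g : MvPolynomial σ R}
    (hf : f ∈ restrictSupportIdeal R S hS) (hg : g ∈ restrictSupportIdeal R T hT) :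
    f * g ∈ restrictSupportIdeal R U hU := by
  have hmul : f * g ∈ restrictSupport R (S + T) := by
    rw [restrictSupport_add]
    exact Submodule.mul_mem_mul hf hg
  exact restrictSupport_mono R (Set.add_subset_iff.mpr h) hmul

theorem restrictSupportIdeal_le_of_monomial_mem {σ R : Type*} [CommSemiring R]
    {S : Set (σ →₀ ℕ)} (hS : IsUpperSet S) {I : Ideal (MvPolynomial σ R)}
    (h : ∀ s ∈ S, monomial s (1 : R) ∈ I) : restrictSupportIdeal R S hS ≤ I := by
  intro f hf
  rw [f.as_sum]
  refine Ideal.sum_mem _ fun s hs => ?_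
  rw [← mul_one (coeff s f), ← C_mul_monomial]
  exact I.mul_mem_left _ (h s (hf hs))

theorem monomial_mem_restrictSupportIdeal {σ R : Type*} [CommSemiring R] {S : Set (σ →₀ ℕ)}
    (hS : IsUpperSet S) {s : σ →₀ ℕ} (r : R) (h : s ∈ S) :
    monomial s r ∈ restrictSupportIdeal R S hS :=
  (monomial_mem_restrictSupport R).mpr (Or.inl h)

theorem isUpperSet_le_add {σ : Type*} (i j : σ) (n : ℕ) :
    IsUpperSet {s : σ →₀ ℕ | n ≤ s i + s j} :=
  fun _ _ hst hs => hs.trans (add_le_add (hst i) (hst j))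

theorem span_pair_X_pow {σ R : Type*} [CommSemiring R] {i j : σ} (hij : i ≠ j) (n : ℕ) :
    (Ideal.span {X i, X j} : Ideal (MvPolynomial σ R)) ^ n =
      restrictSupportIdeal R {s | n ≤ s i + s j} (isUpperSet_le_add i j n) := by
  apply le_antisymm
  · induction n with
    | zero => intro f _ s _; exact Nat.zero_le _
    | succ n ih =>
      rw [pow_succ, Ideal.mul_le]
      intro f hf g hg
      have hspan : Ideal.span {X i, X j} ≤
          restrictSupportIdeal R {s | 1 ≤ s i + s j} (isUpperSet_le_add i j 1) := by
        rw [Ideal.span_le]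
        rintro _ (rfl | rfl) <;>
        · refine monomial_mem_restrictSupportIdeal _ _ ?_
          simp
      refine mul_mem_restrictSupportIdeal _ (fun s hs t ht => ?_) (ih hf) (hspan hg)
      simp only [Set.mem_ofPred_eq, Finsupp.add_apply] at *
      omega
  · refine restrictSupportIdeal_le_of_monomial_mem _ fun s hs => ?_
    have hle : Finsupp.single i (s i) + Finsupp.single j (s j) ≤ s := by
      classical
      intro l
      simp only [Finsupp.add_apply, Finsupp.single_apply]
      split_ifs with h₁ h₂ h₂
      · exact absurd (h₁.trans h₂.symm) hij
      · simp [h₁]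
      · simp [h₂]
      · simp
    have hmul : monomial s (1 : R) = monomial (s - (Finsupp.single i (s i) +
        Finsupp.single j (s j))) 1 * (X i ^ s i * X j ^ s j) := by
      rw [X_pow_eq_monomial, X_pow_eq_monomial, monomial_mul, monomial_mul,
        tsub_add_cancel_of_le hle]
      simp
    rw [hmul]
    refine Ideal.mul_mem_left _ _ (Ideal.pow_le_pow_right hs ?_)
    rw [pow_add]
    exact Ideal.mul_mem_mul (Ideal.pow_mem_pow (Ideal.subset_span (by simp)) _)
      (Ideal.pow_mem_pow (Ideal.subset_span (by simp)) _)

/-- Exponents of the monomials in the ideal of `mP₁₁ + mP₁₂ + mP₂₁`. -/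
def fatExponents (m : ℕ) : Set (Fin 4 →₀ ℕ) :=
  {s | m ≤ s 0 + s 2 ∧ m ≤ s 0 + s 3 ∧ m ≤ s 1 + s 2}

theorem isUpperSet_fatExponents (m : ℕ) : IsUpperSet (fatExponents m) := by
  rintro s t hst ⟨h₁, h₂, h₃⟩
  have := hst 0
  have := hst 1
  have := hst 2
  have := hst 3
  refine ⟨?_, ?_, ?_⟩ <;> omega

theorem IZ_eq_restrictSupportIdeal (F : Type*) [Field F] (m : ℕ) :
    IZ F m m m = restrictSupportIdeal F (fatExponents m) (isUpperSet_fatExponents m) := by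
  unfold IZ I11 I12 I21
  rw [span_pair_X_pow (by decide), span_pair_X_pow (by decide), span_pair_X_pow (by decide)]
  ext f
  change (_ ∧ _) ∧ _ ↔ _
  refine ⟨fun h s hs => ⟨h.1.1 hs, h.1.2 hs, h.2 hs⟩, fun h => ⟨⟨?_, ?_⟩, ?_⟩⟩
  · exact fun s hs => (h hs).1
  · exact fun s hs => (h hs).2.1
  · exact fun s hs => (h hs).2.2

/-- Exponents obtained by raising one coordinate of an exponent in `S`. -/
def shiftedExponents (S : Set (Fin 4 →₀ ℕ)) : Set (Fin 4 →₀ ℕ) :=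
  {s | ∃ i, ∃ t ∈ S, s = Finsupp.single i 1 + t}

theorem shiftedExponents_subset {S : Set (Fin 4 →₀ ℕ)} (hS : IsUpperSet S) :
    shiftedExponents S ⊆ S := by
  rintro _ ⟨i, t, ht, rfl⟩
  exact hS le_add_self ht

theorem isUpperSet_shiftedExponents {S : Set (Fin 4 →₀ ℕ)} (hS : IsUpperSet S) :
    IsUpperSet (shiftedExponents S) := by
  rintro _ u hu ⟨i, t, ht, rfl⟩
  obtain ⟨v, rfl⟩ := exists_add_of_le hu
  exact ⟨i, t + v, hS le_self_add ht, add_assoc _ _ _⟩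

theorem mIdeal_mul_restrictSupportIdeal (F : Type*) [Field F]
    {S : Set (Fin 4 →₀ ℕ)} (hS : IsUpperSet S) :
    mIdeal F * restrictSupportIdeal F S hS =
      restrictSupportIdeal F (shiftedExponents S) (isUpperSet_shiftedExponents hS) := by
  have hX : ∀ i, (X i : MvPolynomial (Fin 4) F) ∈ mIdeal F := by
    intro i
    apply Ideal.subset_span
    fin_cases i <;> simp
  apply le_antisymm
  · rw [Ideal.mul_le]
    intro f hf g hg
    have hle : mIdeal F ≤ restrictSupportIdeal F {s | s ≠ 0} (fun s t hst hs ht => hs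
        (le_antisymm (ht ▸ hst) zero_le)) := by
      rw [mIdeal, Ideal.span_le]
      rintro _ (rfl | rfl | rfl | rfl) <;>
      · refine monomial_mem_restrictSupportIdeal _ _ ?_
        simp
    refine mul_mem_restrictSupportIdeal _ (fun s hs t ht => ?_) (hle hf) hg
    obtain ⟨i, hi⟩ := Finsupp.ne_iff.mp hs
    have hi : Finsupp.single i 1 ≤ s :=
      Finsupp.single_le_iff.mpr (Nat.one_le_iff_ne_zero.mpr hi)
    refine ⟨i, s - Finsupp.single i 1 + t, hS le_add_self ht, ?_⟩
    rw [← add_assoc, add_tsub_cancel_of_le hi]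
  · refine restrictSupportIdeal_le_of_monomial_mem _ ?_
    rintro _ ⟨i, t, ht, rfl⟩
    have hmul : monomial (Finsupp.single i 1 + t) (1 : F) = X i * monomial t 1 := by
      rw [X, monomial_mul, one_mul]
    rw [hmul]
    exact Ideal.mul_mem_mul (hX i) (monomial_mem_restrictSupportIdeal hS _ ht)

theorem finrank_restrictSupportIdeal_inf_comp (F : Type*) [Field F]
    {S : Set (Fin 4 →₀ ℕ)} (hS : IsUpperSet S) (a b : ℕ) :
    finrank F ↥((restrictSupportIdeal F S hS).restrictScalars F ⊓ comp F a b) =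
      (S ∩ {s | Finsupp.weight w s = (a, b)}).ncard := by
  have heq : (restrictSupportIdeal F S hS).restrictScalars F ⊓ comp F a b =
      restrictSupport F (S ∩ {s | Finsupp.weight w s = (a, b)}) := by
    ext f
    rw [restrictScalars_restrictSupportIdeal, comp,
      weightedHomogeneousSubmodule_eq_finsupp_supported]
    exact Set.subset_inter_iff.symm
  rw [heq, finrank_eq_nat_card_basis (basisRestrictSupport F _), Nat.card_coe_set_eq]

theorem weight_w_eq_iff (s : Fin 4 →₀ ℕ) (a b : ℕ) :
    Finsupp.weight w s = (a, b) ↔ s 0 + s 1 = a ∧ s 2 + s 3 = b := by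
  rw [Finsupp.weight_apply, Finsupp.sum_fintype _ _ (by simp)]
  simp [Fin.sum_univ_four, w, -nsmul_eq_mul, -smul_eq_mul]

theorem finite_weight_w_eq (a b : ℕ) : {s : Fin 4 →₀ ℕ | Finsupp.weight w s = (a, b)}.Finite := by
  refine (Set.finite_Iic (Finsupp.equivFunOnFinite.symm fun _ : Fin 4 => a + b)).subset ?_
  intro s hs i
  obtain ⟨h₁, h₂⟩ := (weight_w_eq_iff s a b).mp hs
  simp only [Finsupp.equivFunOnFinite_symm_apply_apply]
  fin_cases i <;> simp <;> omega

theorem beta0_restrictSupportIdeal (F : Type*) [Field F]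
    {S : Set (Fin 4 →₀ ℕ)} (hS : IsUpperSet S) (a b : ℕ) :
    beta0 F (restrictSupportIdeal F S hS) a b =
      ((S \ shiftedExponents S) ∩ {s | Finsupp.weight w s = (a, b)}).ncard := by
  rw [beta0, mIdeal_mul_restrictSupportIdeal, finrank_restrictSupportIdeal_inf_comp,
    finrank_restrictSupportIdeal_inf_comp, Set.inter_comm (S \ _), Set.inter_sdiff_distrib_left,
    Set.inter_comm _ S, Set.inter_comm _ (shiftedExponents S),
    Set.cast_ncard_sdiff
      (Set.inter_subset_inter_left _ (shiftedExponents_subset hS))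
      ((finite_weight_w_eq a b).subset Set.inter_subset_right)]

theorem fatExponents_diff_shiftedExponents (m : ℕ) :
    fatExponents m \ shiftedExponents (fatExponents m) =
      {s | m ≤ s 0 + s 2 ∧ s 0 + s 3 = m ∧ s 1 + s 2 = m} := by
  ext s
  constructor
  · rintro ⟨⟨h₁, h₂, h₃⟩, hs⟩
    have key : ∀ i, 1 ≤ s i → s - Finsupp.single i 1 ∉ fatExponents m := by
      intro i hi hmem
      exact hs ⟨i, _, hmem, (add_tsub_cancel_of_le (Finsupp.single_le_iff.mpr hi)).symm⟩
    have k0 := key 0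
    have k1 := key 1
    have k2 := key 2
    have k3 := key 3
    simp [fatExponents] at k0 k1 k2 k3
    refine ⟨h₁, ?_, ?_⟩
    · by_contra hne
      by_cases h : 1 ≤ s 3 <;> omega
    · by_contra hne
      by_cases h : 1 ≤ s 1 <;> omega
  · rintro ⟨h₁, h₂, h₃⟩
    refine ⟨⟨h₁, h₂.ge, h₃.ge⟩, ?_⟩
    rintro ⟨i, t, ⟨t₁, t₂, t₃⟩, rfl⟩
    fin_cases i <;> simp at h₂ h₃ <;> omega

/-- The exponent vector of the minimal generator of bidegree `(2m - b, b)` with `x₁`-exponent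
`v`. -/
def minimalExponent (m b v : ℕ) : Fin 4 →₀ ℕ :=
  Finsupp.equivFunOnFinite.symm ![2 * m - b - v, v, m - v, v + b - m]

theorem minimalExponent_injective (m b : ℕ) : Function.Injective (minimalExponent m b) := by
  intro v v' h
  simpa [minimalExponent] using DFunLike.congr_fun h 1

theorem ncard_minimalExponents {m a b : ℕ} (hab : a + b = 2 * m) :
    ({s : Fin 4 →₀ ℕ | m ≤ s 0 + s 2 ∧ s 0 + s 3 = m ∧ s 1 + s 2 = m} ∩
      {s | Finsupp.weight w s = (a, b)}).ncard = a / 2 + 1 - (m - b) := by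
  have himage : {s : Fin 4 →₀ ℕ | m ≤ s 0 + s 2 ∧ s 0 + s 3 = m ∧ s 1 + s 2 = m} ∩
      {s | Finsupp.weight w s = (a, b)} =
      minimalExponent m b '' (Finset.Icc (m - b) (a / 2) : Finset ℕ) := by
    ext s
    simp only [Set.mem_inter_iff, Set.mem_ofPred_eq, weight_w_eq_iff, Set.mem_image,
      Finset.coe_Icc, Set.mem_Icc]
    constructor
    · rintro ⟨⟨h₁, h₂, h₃⟩, h₄, h₅⟩
      refine ⟨s 1, by omega, ?_⟩
      ext i
      fin_cases i <;> simp [minimalExponent] <;> omega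
    · rintro ⟨v, ⟨h₁, h₂⟩, rfl⟩
      simp [minimalExponent]
      omega
  rw [himage, Set.ncard_image_of_injective _ (minimalExponent_injective m b),
    Set.ncard_coe_finset, Nat.card_Icc]

theorem phiNat_succ {m a b : ℕ} (hab : a + b = 2 * m) :
    phiNat (m + 1) b = ((a / 2 + 1 - (m - b) : ℕ) : ℤ) := by
  have closed : ∀ m n : ℕ, phiNat (m + 1) n =
      if n ≤ 2 * m then ((min n (2 * m - n) / 2 + 1 : ℕ) : ℤ) else 0 := by
    intro m
    induction m with
    | zero => intro n; simp [phiNat]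
    | succ m ih =>
      intro n
      rw [phiNat, ih]
      split_ifs <;> omega
  rw [closed, if_pos (by omega)]
  omega

/-- Corollary 4.7: for a homogeneous set of fat points `Z = mP₁₁ + mP₁₂ + mP₂₁`,
`β_{0,(a,b)}(I_Z) = φ_{m+1}(b)` if `a + b = 2m` and `0` otherwise. -/
theorem beta0_homogeneous_fat_points (m : ℕ) (a b : ℕ) :
    (a + b = 2 * m → beta0 k (IZ k m m m) a b = phi ((m : ℤ) + 1) b) ∧
    (a + b ≠ 2 * m → beta0 k (IZ k m m m) a b = 0) := by
  have hbeta : beta0 k (IZ k m m m) a b =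
      ({s : Fin 4 →₀ ℕ | m ≤ s 0 + s 2 ∧ s 0 + s 3 = m ∧ s 1 + s 2 = m} ∩
        {s | Finsupp.weight w s = (a, b)}).ncard := by
    rw [IZ_eq_restrictSupportIdeal, beta0_restrictSupportIdeal,
      fatExponents_diff_shiftedExponents]
  refine ⟨fun hab => ?_, fun hab => ?_⟩
  · rw [hbeta, ncard_minimalExponents hab, phi, if_pos (by positivity), ← phiNat_succ hab]
    rfl
  · rw [hbeta, Nat.cast_eq_zero]
    convert Set.ncard_empty (Fin 4 →₀ ℕ)
    refine Set.eq_empty_of_forall_notMem ?_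
    rintro s ⟨⟨-, h₁, h₂⟩, hs⟩
    obtain ⟨h₃, h₄⟩ := (weight_w_eq_iff s a b).mp hs
    omega

end
end

section
/- Let m_11, m_12, m_21 be integers with 0 ≤ m_11 ≤ m_21 ≤ m_12 and let Z = m_11 P_11 + m_12 P_12 + m_21 P_21. Then for all integers a, b ≥ 0: ΔH_Z(a,b) = 1 if a + b < m_12 + m_21; ΔH_Z(a,b) = 1 − (min{a, b − m_11, m_21 − m_11} + 1)_+ − φ_{m_12, m_12 − m_11}(b) if a + b = m_12 + m_21; and ΔH_Z(a,b) = 0 if a + b > m_12 + m_21. -/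
open MvPolynomial Module

noncomputable section

variable (k : Type*) [Field k] [CharZero k]

/-- Closed form of `phiNat`. -/
theorem phiNat_eq (t : ℕ) (n : ℤ) :
    phiNat t n = max 0 (min (n / 2 + 1) ((2 * t - n) / 2)) := by
  induction t with
  | zero => simp only [phiNat]; omega
  | succ t ih =>
    cases t with
    | zero => simp only [phiNat]; split_ifs <;> omega
    | succ t =>
      simp only [phiNat, ih]
      push_cast
      split_ifs <;> omega

/-- Closed form of `phi`. -/
theorem phi_eq (t n : ℤ) (ht : 0 ≤ t) : phi t n = max 0 (min (n / 2 + 1) ((2 * t - n) / 2)) := by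
  unfold phi
  split_ifs
  · rw [phiNat_eq, Int.toNat_of_nonneg ht]
  · omega

theorem span_X_pair_pow {σ R : Type*} [CommSemiring R] {i j : σ} (hij : i ≠ j) (m : ℕ) :
    (Ideal.span {X i, X j} : Ideal (MvPolynomial σ R)) ^ m =
      Ideal.span ((fun d => monomial d (1 : R)) '' {d : σ →₀ ℕ | m ≤ d i + d j}) := by
  classical
  apply le_antisymm
  · induction m with
    | zero =>
      rw [pow_zero, Ideal.one_eq_top, top_le_iff, Ideal.eq_top_iff_one]
      exact Ideal.subset_span ⟨0, by simp, rfl⟩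
    | succ m ih =>
      rw [pow_succ]
      refine (Ideal.mul_mono_left ih).trans ?_
      rw [Ideal.span_mul_span', Ideal.span_le]
      rintro _ ⟨_, ⟨d, hd, rfl⟩, _, hX, rfl⟩
      rw [Set.mem_ofPred_eq] at hd
      apply Ideal.subset_span
      rcases hX with rfl | rfl
      · refine ⟨d + Finsupp.single i 1, ?_, by simp only [monomial_add_single, pow_one]⟩
        simp [hij]; omega
      · refine ⟨d + Finsupp.single j 1, ?_, by simp only [monomial_add_single, pow_one]⟩
        simp [hij.symm]; omega
  · rw [Ideal.span_le]
    rintro _ ⟨d, hd, rfl⟩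
    rw [Set.mem_ofPred_eq] at hd
    induction m generalizing d with
    | zero => simp
    | succ m ih =>
      rw [pow_succ]
      have peel (l : σ) (hl : d l ≠ 0) (hX : (X l : MvPolynomial σ R) ∈ ({X i, X j} : Set _))
          (hm : m ≤ (d - Finsupp.single l 1 : σ →₀ ℕ) i + (d - Finsupp.single l 1 : σ →₀ ℕ) j) :
          monomial d (1 : R) ∈
            (Ideal.span {X i, X j} : Ideal (MvPolynomial σ R)) ^ m * Ideal.span {X i, X j} := by
        rw [← Finsupp.sub_add_single_one_cancel hl, monomial_add_single, pow_one]
        exact Ideal.mul_mem_mul (ih _ hm) (Ideal.subset_span hX)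
      by_cases hi : d i = 0
      · exact peel j (by omega) (by simp) (by simp [hij.symm]; omega)
      · exact peel i hi (by simp) (by simp [hij]; omega)

theorem mem_span_X_pair_pow {σ R : Type*} [CommSemiring R] {i j : σ} (hij : i ≠ j) (m : ℕ)
    (f : MvPolynomial σ R) :
    f ∈ (Ideal.span {X i, X j} : Ideal (MvPolynomial σ R)) ^ m ↔
      ∀ d ∈ f.support, m ≤ d i + d j := by
  rw [span_X_pair_pow hij, mem_ideal_span_monomial_image]
  refine forall₂_congr fun d _ => ⟨?_, fun h => ⟨d, h, le_rfl⟩⟩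
  rintro ⟨e, he, hle⟩
  exact le_trans he (add_le_add (hle i) (hle j))

theorem weight_w (d : Fin 4 →₀ ℕ) : Finsupp.weight w d = (d 0 + d 1, d 2 + d 3) := by
  rw [Finsupp.weight_apply, Finsupp.sum_fintype _ _ (by simp), Fin.sum_univ_four]
  simp [w]

/-- The pairs of exponents `(i, j)` of the monomials `x₀ⁱ x₁ᵃ⁻ⁱ x₂ʲ x₃ᵇ⁻ʲ` of bidegree `(a, b)`
lying in the ideal of `p P₁₁ + q P₁₂ + r P₂₁`. -/
def exponents (p q r a b : ℤ) : Finset (ℤ × ℤ) :=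
  {e ∈ Finset.Icc 0 a ×ˢ Finset.Icc 0 b |
    p ≤ e.1 + e.2 ∧ q ≤ e.1 + (b - e.2) ∧ r ≤ a - e.1 + e.2}

theorem mem_exponents {p q r a b : ℤ} {e : ℤ × ℤ} :
    e ∈ exponents p q r a b ↔ ((0 ≤ e.1 ∧ e.1 ≤ a) ∧ 0 ≤ e.2 ∧ e.2 ≤ b) ∧
      p ≤ e.1 + e.2 ∧ q ≤ e.1 + (b - e.2) ∧ r ≤ a - e.1 + e.2 := by
  simp [exponents]

theorem finrank_IZ (K : Type*) [Field K] (p q r a b : ℕ) :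
    finrank K ↥((IZ K p q r).restrictScalars K ⊓ comp K a b) =
      (exponents p q r a b).card := by
  have hI : (IZ K p q r).restrictScalars K ⊓ comp K a b =
      restrictSupport K {d : Fin 4 →₀ ℕ | (d 0 + d 1 = a ∧ d 2 + d 3 = b) ∧
        p ≤ d 0 + d 2 ∧ q ≤ d 0 + d 3 ∧ r ≤ d 1 + d 2} := by
    ext f
    simp only [IZ, I11, I12, I21, comp, Submodule.mem_inf, Submodule.restrictScalars_mem,
      mem_span_X_pair_pow (show (0 : Fin 4) ≠ 2 by decide),
      mem_span_X_pair_pow (show (0 : Fin 4) ≠ 3 by decide),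
      mem_span_X_pair_pow (show (1 : Fin 4) ≠ 2 by decide),
      mem_weightedHomogeneousSubmodule, IsWeightedHomogeneous, mem_restrictSupport_iff, weight_w,
      Set.subset_def, SetLike.mem_coe, MvPolynomial.mem_support_iff, Set.mem_ofPred_eq, Prod.mk.injEq]
    grind
  rw [hI, finrank_eq_nat_card_basis (basisRestrictSupport K _), ← Nat.card_eq_finsetCard]
  refine Nat.card_congr (Equiv.ofBijective (fun d => ⟨((d.1 0 : ℤ), (d.1 2 : ℤ)), ?_⟩) ⟨?_, ?_⟩)
  · have := d.2
    simp only [Set.mem_ofPred_eq] at this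
    simp only [mem_exponents]
    omega
  · rintro ⟨d, hd⟩ ⟨e, he⟩ hde
    simp only [Set.mem_ofPred_eq] at hd he
    simp only [Subtype.mk.injEq, Prod.mk.injEq, Nat.cast_inj] at hde
    simp only [Subtype.mk.injEq]
    ext l
    fin_cases l <;> simp <;> omega
  · rintro ⟨⟨i, j⟩, he⟩
    simp only [mem_exponents] at he
    refine ⟨⟨Finsupp.equivFunOnFinite.symm
      ![i.toNat, a - i.toNat, j.toNat, b - j.toNat], ?_⟩, ?_⟩
    · simp
      omega
    · simp
      omega

theorem HF_IZ (K : Type*) [Field K] (p q r : ℕ) (a b : ℤ) (ha : -1 ≤ a) (hb : -1 ≤ b) :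
    HF K (IZ K p q r) a b = (a + 1) * (b + 1) - (exponents p q r a b).card := by
  unfold HF
  split_ifs with h
  · rw [finrank_IZ, Int.toNat_of_nonneg h.1, Int.toNat_of_nonneg h.2]
  · have h0 : exponents p q r a b = ∅ := by
      ext e
      simp only [mem_exponents, Finset.notMem_empty, iff_false]
      omega
    have h1 : a + 1 = 0 ∨ b + 1 = 0 := by omega
    rcases h1 with h1 | h1 <;> simp [h0, h1]

/-- The monomials of bidegree `(a, b)` in the ideal that are not divisible, within the ideal,
by `x₁` or by `x₃`. -/
def minExponents (p q r a b : ℤ) : Finset (ℤ × ℤ) :=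
  {e ∈ exponents p q r a b |
    (e.1 = a ∨ a - e.1 + e.2 = r) ∧ (e.2 = b ∨ e.1 + (b - e.2) = q)}

theorem mem_minExponents {p q r a b : ℤ} {e : ℤ × ℤ} :
    e ∈ minExponents p q r a b ↔ e ∈ exponents p q r a b ∧
      (e.1 = a ∨ a - e.1 + e.2 = r) ∧ (e.2 = b ∨ e.1 + (b - e.2) = q) := by
  simp [minExponents]

theorem card_exponents_add (p q r a b : ℤ) :
    (exponents p q r a b).card + (exponents p q r (a - 1) (b - 1)).card =
      (minExponents p q r a b).card +
        ((exponents p q r (a - 1) b).card + (exponents p q r a (b - 1)).card) := by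
  have hinter : exponents p q r (a - 1) (b - 1) =
      exponents p q r (a - 1) b ∩ exponents p q r a (b - 1) := by
    ext e
    simp only [Finset.mem_inter, mem_exponents]
    omega
  have hsub : exponents p q r (a - 1) b ∪ exponents p q r a (b - 1) ⊆ exponents p q r a b := by
    intro e
    simp only [Finset.mem_union, mem_exponents]
    omega
  have hmin : minExponents p q r a b =
      exponents p q r a b \ (exponents p q r (a - 1) b ∪ exponents p q r a (b - 1)) := by
    ext e
    simp only [Finset.mem_sdiff, Finset.mem_union, mem_minExponents, mem_exponents]
    omega
  rw [hmin, hinter, ← Finset.card_union_add_card_inter (exponents p q r (a - 1) b), ← add_assoc,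
    Finset.card_sdiff_add_card_eq_card hsub]

theorem dHF_IZ (K : Type*) [Field K] (p q r a b : ℕ) :
    dHF K (IZ K p q r) a b = 1 - (minExponents p q r a b).card := by
  have h := card_exponents_add p q r a b
  zify at h
  unfold dHF
  rw [HF_IZ, HF_IZ, HF_IZ, HF_IZ] <;> first | omega | linear_combination -h

theorem minExponents_of_lt {p q r a b : ℤ} (h : a + b < q + r) : minExponents p q r a b = ∅ := by
  ext e
  simp only [mem_minExponents, mem_exponents, Finset.notMem_empty, iff_false]
  omega

theorem minExponents_of_gt {p q r a b : ℤ} (hp : 0 ≤ p) (hpr : p ≤ r) (hrq : r ≤ q) (ha : 0 ≤ a)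
    (hb : 0 ≤ b) (h : q + r < a + b) :
    minExponents p q r a b = {(min a (a - r + b), min b (b - q + a))} := by
  ext e
  simp only [mem_minExponents, mem_exponents, Finset.mem_singleton, Prod.ext_iff]
  omega

theorem card_minExponents_of_eq {p q r a b : ℤ} (h : a + b = q + r) :
    (minExponents p q r a b).card =
      (min b r + 1 - max (max 0 (r - a)) ((p + r - a + 1) / 2)).toNat := by
  have himg : minExponents p q r a b =
      (Finset.Icc (max (max 0 (r - a)) ((p + r - a + 1) / 2)) (min b r)).image
        fun j => (j + a - r, j) := by
    ext ⟨i, j⟩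
    simp only [mem_minExponents, mem_exponents, Finset.mem_image, Finset.mem_Icc, Prod.mk.injEq,
      exists_eq_right_right]
    omega
  rw [himg, Finset.card_image_of_injective _ fun x y hxy => (Prod.mk.inj hxy).2, Int.card_Icc]

/-- Proposition 5.3: first difference of the Hilbert function of
`Z = m₁₁P₁₁ + m₁₂P₁₂ + m₂₁P₂₁` when `0 ≤ m₁₁ ≤ m₂₁ ≤ m₁₂`. -/
theorem deltaHF_three_fat_points_case1 (m11 m12 m21 : ℕ)
    (h1 : m11 ≤ m21) (h2 : m21 ≤ m12) (a b : ℕ) :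
    ((a : ℤ) + b < (m12 : ℤ) + m21 → dHF k (IZ k m11 m12 m21) a b = 1) ∧
    ((a : ℤ) + b = (m12 : ℤ) + m21 → dHF k (IZ k m11 m12 m21) a b =
      1 - pos (min (min (a : ℤ) ((b : ℤ) - m11)) ((m21 : ℤ) - m11) + 1) -
        phi2 (m12 : ℤ) ((m12 : ℤ) - m11) b) ∧
    ((a : ℤ) + b > (m12 : ℤ) + m21 → dHF k (IZ k m11 m12 m21) a b = 0) := by
  rw [dHF_IZ]
  refine ⟨fun h => ?_, fun h => ?_, fun h => ?_⟩
  · simp [minExponents_of_lt h]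
  · rw [card_minExponents_of_eq h]
    simp only [phi2, pos, phi_eq _ _ (Int.natCast_nonneg m12),
      phi_eq ((m12 : ℤ) - m11) _ (by omega)]
    omega
  · rw [minExponents_of_gt (by omega) (by omega) (by omega) (by omega) (by omega) h]
    simp

end
end
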